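/- Let (X, Σ, μ) be a complete finite measure space and ℓ a von Neumann lifting of μ. For each x ∈ X let ω_x be an ultrafilter on 𝓘^ℓ_x containing 𝓤^ℓ_x(I) := {J ∈ 𝓘^ℓ_x : J ⊆ I} for every I ∈ 𝓘^ℓ_x. Then for every f ∈ L∞(μ) and every x ∈ X it holds that ℓ(f)(x) equals the ultralimit along ω_x of I ↦ ⨍_I f dμ. -/

import Mathlib

open MeasureTheory Set Filter

/-- A von Neumann lifting of a measure `μ`: a Boolean homomorphism `ℓ : Σ → Σ` selecting
a.e.-representatives. -/
structure IsVNLifting {X : Type*} [MeasurableSpace X] (μ : MeasureTheory.Measure X)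
    (ℓ : Set X → Set X) : Prop where
  measurableSet : ∀ E : Set X, MeasurableSet E → MeasurableSet (ℓ E)
  map_empty : ℓ (∅ : Set X) = ∅
  map_univ : ℓ (Set.univ : Set X) = Set.univ
  map_inter : ∀ E F : Set X, MeasurableSet E → MeasurableSet F → ℓ (E ∩ F) = ℓ E ∩ ℓ F
  map_union : ∀ E F : Set X, MeasurableSet E → MeasurableSet F → ℓ (E ∪ F) = ℓ E ∪ ℓ F
  congr_ae : ∀ E F : Set X, MeasurableSet E → MeasurableSet F →
    μ (symmDiff E F) = 0 → ℓ E = ℓ F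
  ae_symmDiff : ∀ E : Set X, MeasurableSet E → μ (symmDiff E (ℓ E)) = 0
/-- The differentiation basis `𝓘^ℓ` induced by a lifting `ℓ`: all sets `ℓ E` with
`E` measurable of positive finite measure. -/
def liftBasis {X : Type*} [MeasurableSpace X] (μ : MeasureTheory.Measure X)
    (ℓ : Set X → Set X) : Set (Set X) :=
  {I | ∃ E : Set X, MeasurableSet E ∧ 0 < μ E ∧ μ E < ⊤ ∧ I = ℓ E}

/-- `HasDLim ℐ x Φ y` means `lim_{I ⇒ x} Φ(I) = y` along the differentiation basis `ℐ`:
for every neighbourhood `U` of `y` there is `I ∈ ℐ_x` with `Φ J ∈ U` for every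
`J ∈ ℐ_x` with `J ⊆ I`. -/
def HasDLim {X Y : Type*} [TopologicalSpace Y] (ℐ : Set (Set X)) (x : X)
    (Φ : Set X → Y) (y : Y) : Prop :=
  ∀ U ∈ nhds y, ∃ I ∈ ℐ, x ∈ I ∧ ∀ J ∈ ℐ, x ∈ J → J ⊆ I → Φ J ∈ U
/-- The family `𝓘^ℓ_x` of elements of the differentiation basis `𝓘^ℓ` containing `x`. -/
def basisAt {X : Type*} [MeasurableSpace X] (μ : MeasureTheory.Measure X)
    (ℓ : Set X → Set X) (x : X) : Set (Set X) :=
  {I | I ∈ liftBasis μ ℓ ∧ x ∈ I}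
/-- The lifting of functions `L : L∞(μ) → ℒ∞(Σ)` induced by a von Neumann lifting `ℓ`:
it is linear, norm-nonincreasing pointwise, selects representatives, and sends the class
of an indicator `1_E` to `1_{ℓ E}`. -/
def IsLinftyLifting {X : Type*} [MeasurableSpace X] (μ : MeasureTheory.Measure X)
    (ℓ : Set X → Set X) (L : MeasureTheory.Lp ℝ ⊤ μ → X → ℝ) : Prop :=
  (∀ f g : MeasureTheory.Lp ℝ ⊤ μ, L (f + g) = L f + L g) ∧
  (∀ (c : ℝ) (f : MeasureTheory.Lp ℝ ⊤ μ), L (c • f) = c • L f) ∧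
  (∀ f : MeasureTheory.Lp ℝ ⊤ μ, Measurable (L f)) ∧
  (∀ (f : MeasureTheory.Lp ℝ ⊤ μ) (x : X), |L f x| ≤ ‖f‖) ∧
  (∀ f : MeasureTheory.Lp ℝ ⊤ μ, L f =ᵐ[μ] f) ∧
  (∀ E : Set X, MeasurableSet E → ∀ f : MeasureTheory.Lp ℝ ⊤ μ,
    (f : X → ℝ) =ᵐ[μ] E.indicator 1 → L f = (ℓ E).indicator 1)

/-- A lower bound for `f` on `A` is inherited by its lifting at every point of `ℓ A`. -/
theorem IsLinftyLifting.le_apply {X : Type*} [MeasurableSpace X] {μ : Measure X}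
    [IsFiniteMeasure μ] {ℓ : Set X → Set X} {L : Lp ℝ ⊤ μ → X → ℝ}
    (hL : IsLinftyLifting μ ℓ L) {A : Set X} (hA : MeasurableSet A) {f : Lp ℝ ⊤ μ} {b : ℝ}
    (hb : ∀ᵐ y ∂μ, y ∈ A → b ≤ f y) {x : X} (hx : x ∈ ℓ A) : b ≤ L f x := by
  obtain ⟨h_add, h_smul, -, h_norm, h_ae, h_ind⟩ := hL
  set K : ℝ := 2 * ‖f‖ + |b| with hK
  have hKb : 2 * ‖f‖ ≤ K - b := by linarith [le_abs_self b]
  have hf0 : 0 ≤ ‖f‖ := norm_nonneg f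
  let e : Lp ℝ ⊤ μ := indicatorConstLp ⊤ hA (measure_ne_top μ A) (1 : ℝ)
  have he : (e : X → ℝ) =ᵐ[μ] A.indicator 1 := indicatorConstLp_coeFn
  have hu : ‖f + (-K) • e‖ ≤ K - b := by
    refine (Lp.norm_le_of_ae_bound (C := K - b) (by linarith) ?_).trans ?_
    · filter_upwards [he, Lp.coeFn_add f ((-K) • e), Lp.coeFn_smul (-K) e, hb,
        h_ae f] with y h1 h2 h3 h4 h5
      rw [h2, Pi.add_apply, h3, Pi.smul_apply, h1, Real.norm_eq_abs, abs_le]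
      have h6 := abs_le.mp (h5 ▸ h_norm f y)
      by_cases hy : y ∈ A
      · have := h4 hy
        simp only [indicator_of_mem hy, Pi.one_apply, smul_eq_mul, mul_one]
        constructor <;> linarith [abs_nonneg b]
      · simp only [indicator_of_notMem hy, smul_zero, add_zero]
        constructor <;> linarith
    · simp
  have h := (h_norm (f + (-K) • e) x).trans hu
  rw [h_add, h_smul, h_ind A hA e he, Pi.add_apply, Pi.smul_apply, indicator_of_mem hx,
    Pi.one_apply, smul_eq_mul, abs_le] at h
  linarith [h.1]

/-- An upper bound for `f` on `A` is inherited by its lifting at every point of `ℓ A`. -/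
theorem IsLinftyLifting.apply_le {X : Type*} [MeasurableSpace X] {μ : Measure X}
    [IsFiniteMeasure μ] {ℓ : Set X → Set X} {L : Lp ℝ ⊤ μ → X → ℝ}
    (hL : IsLinftyLifting μ ℓ L) {A : Set X} (hA : MeasurableSet A) {f : Lp ℝ ⊤ μ} {b : ℝ}
    (hb : ∀ᵐ y ∂μ, y ∈ A → f y ≤ b) {x : X} (hx : x ∈ ℓ A) : L f x ≤ b := by
  have h : -b ≤ L ((-1 : ℝ) • f) x := by
    refine hL.le_apply hA ?_ hx
    filter_upwards [hb, Lp.coeFn_smul (-1 : ℝ) f] with y h1 h2 hy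
    rw [h2, Pi.smul_apply, smul_eq_mul]
    linarith [h1 hy]
  rw [hL.2.1, Pi.smul_apply, smul_eq_mul] at h
  linarith

/-- Every point `x` lies in the lifting of the set where `L f` is close to `L f x`. -/
theorem IsLinftyLifting.mem_lift_preimage_ball {X : Type*} [MeasurableSpace X] {μ : Measure X}
    [IsFiniteMeasure μ] {ℓ : Set X → Set X} {L : Lp ℝ ⊤ μ → X → ℝ}
    (hL : IsLinftyLifting μ ℓ L) (hℓ : IsVNLifting μ ℓ) (f : Lp ℝ ⊤ μ) (x : X) {ε : ℝ}
    (hε : 0 < ε) : x ∈ ℓ (L f ⁻¹' Metric.ball (L f x) ε) := by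
  have hm : Measurable (L f) := hL.2.2.1 f
  have hae : L f =ᵐ[μ] f := hL.2.2.2.2.1 f
  have hE : MeasurableSet (L f ⁻¹' Metric.ball (L f x) ε) := hm measurableSet_ball
  have hP : MeasurableSet (L f ⁻¹' Ici (L f x + ε)) := hm measurableSet_Ici
  have hN : MeasurableSet (L f ⁻¹' Iic (L f x - ε)) := hm measurableSet_Iic
  have hcover : L f ⁻¹' Metric.ball (L f x) ε ∪
      (L f ⁻¹' Ici (L f x + ε) ∪ L f ⁻¹' Iic (L f x - ε)) = univ := by
    refine eq_univ_of_forall fun y => ?_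
    simp only [mem_union, mem_preimage, Real.ball_eq_Ioo, mem_Ioo, mem_Ici, mem_Iic]
    grind
  have hx : x ∈ ℓ univ := by rw [hℓ.map_univ]; exact mem_univ x
  rw [← hcover, hℓ.map_union _ _ hE (hP.union hN), hℓ.map_union _ _ hP hN] at hx
  rcases hx with hx | hx | hx
  · exact hx
  · have := hL.le_apply hP (f := f) (b := L f x + ε)
      (by filter_upwards [hae] with y hy h using hy ▸ h) hx
    linarith
  · have := hL.apply_le hN (f := f) (b := L f x - ε)
      (by filter_upwards [hae] with y hy h using hy ▸ h) hx
    linarith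

/-- A lifting does not change a measurable set up to null sets. -/
theorem IsVNLifting.ae_eq {X : Type*} [MeasurableSpace X] {μ : Measure X} {ℓ : Set X → Set X}
    (hℓ : IsVNLifting μ ℓ) {E : Set X} (hE : MeasurableSet E) : E =ᵐ[μ] ℓ E :=
  measure_symmDiff_eq_zero_iff.mp (hℓ.ae_symmDiff E hE)

/-- **Compatibility of the lifting with the induced ultrafilters.** If `ω_x` is a family of
ultrafilters on `𝓘^ℓ_x` containing every `𝓤^ℓ_x(I)`, then for every `f ∈ L∞(μ)` and *every*
point `x`, the value `ℓ(f)(x)` is the ultralimit along `ω_x` of the averages `⨍_I f dμ`. -/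
theorem lifting_eq_ultralimit_of_averages {X : Type*} [MeasurableSpace X]
    (μ : Measure X) [IsFiniteMeasure μ] (hc : μ.IsComplete)
    (ℓ : Set X → Set X) (hℓ : IsVNLifting μ ℓ)
    (L : Lp ℝ ⊤ μ → X → ℝ) (hL : IsLinftyLifting μ ℓ L)
    (ω : ∀ x : X, Ultrafilter (basisAt μ ℓ x))
    (hω : ∀ (x : X) (I : basisAt μ ℓ x),
      {J : basisAt μ ℓ x | (J : Set X) ⊆ (I : Set X)} ∈ ω x) :
    ∀ (f : Lp ℝ ⊤ μ) (x : X),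
      Filter.Tendsto (fun I : basisAt μ ℓ x => ⨍ z in (I : Set X), f z ∂μ)
        (ω x : Filter (basisAt μ ℓ x)) (nhds (L f x)) := by
  intro f x
  rw [Metric.nhds_basis_closedBall.tendsto_right_iff]
  intro ε hε
  set E : Set X := L f ⁻¹' Metric.ball (L f x) ε
  have hE : MeasurableSet E := hL.2.2.1 f measurableSet_ball
  have hxE : x ∈ ℓ E := hL.mem_lift_preimage_ball hℓ f x hε
  have hpos : 0 < μ E := by
    refine pos_iff_ne_zero.mpr fun h0 => ?_
    rw [hℓ.congr_ae E ∅ hE .empty (by simpa [symmDiff] using h0), hℓ.map_empty] at hxE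
    exact hxE
  filter_upwards [hω x ⟨ℓ E, ⟨E, hE, hpos, measure_lt_top μ E, rfl⟩, hxE⟩]
  rintro ⟨_, ⟨F, hF, hF0, -, rfl⟩, -⟩ (hJ : ℓ F ⊆ ℓ E)
  refine (convex_closedBall (L f x) ε).set_average_mem Metric.isClosed_closedBall
    ?_ (measure_ne_top μ _) ?_ ?_
  · rw [← measure_congr (hℓ.ae_eq hF)]
    exact hF0.ne'
  · rw [ae_restrict_iff' (hℓ.measurableSet F hF)]
    filter_upwards [(hℓ.ae_eq hE).mem_iff, hL.2.2.2.2.1 f] with y h1 h2 hy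
    exact h2 ▸ Metric.ball_subset_closedBall (h1.mpr (hJ hy))
  · exact ((Lp.memLp f).integrable le_top).integrableOn
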